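/- Let d ≥ 1 and let Z : ℝ^d → ℝ be measurable, essentially bounded on some neighborhood of the origin, and (Fréchet) differentiable at the origin with ∂_i Z(0) ≠ 0 for every i = 1,…,d. Then for every r = (r_1,…,r_d) ∈ (0,∞)^d there exist α > 0 and a bijection h : ℕ → ℕ^d such that for every l ∈ ℕ: (i) ∑_{i=1}^d |h(l+1)_i − h(l)_i| = 1, and (ii) ∫_{B_α} Z(x) ψ_{h(l)}^α(x) ψ_{h(l+1)}^α(x) dx ≠ 0, where B_α = (0, α r_1)×⋯×(0, α r_d) and ψ_k^α(x) = (2^{d/2}/(α^{d/2}√(∏_{i=1}^d r_i))) ∏_{i=1}^d sin(k_i π x_i / (α r_i)). -/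

import Mathlib

open MeasureTheory

/-- The normalized Dirichlet eigenfunctions of the Laplacian on the scaled orthotope
`(0, α r_1) × ⋯ × (0, α r_d)`. -/
noncomputable def psiA (d : ℕ) (r : Fin d → ℝ) (α : ℝ) (k : Fin d → ℕ)
    (x : Fin d → ℝ) : ℝ :=
  (2 : ℝ) ^ ((d : ℝ) / 2) / (α ^ ((d : ℝ) / 2) * Real.sqrt (∏ i, r i)) *
    ∏ i, Real.sin (k i * Real.pi * x i / (α * r i))

section GridPath

/-- A Hamiltonian path of the grid `ℕ × ℕ`, traversing the shells `max a b = s` one after the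
other in alternating directions. -/
def shellPath (n : ℕ) : ℕ × ℕ :=
  let s := n.sqrt
  let t := n - s * s
  if s % 2 = 0 then (min s (2 * s - t), min s t) else (min s t, min s (2 * s - t))

lemma exists_shell (n : ℕ) : ∃ s t, t ≤ 2 * s ∧ n = s * s + t :=
  ⟨n.sqrt, n - n.sqrt * n.sqrt, by have := Nat.sqrt_le_add n; omega,
    by have := Nat.sqrt_le n; omega⟩

lemma shellPath_add {s t : ℕ} (h : t ≤ 2 * s) : shellPath (s * s + t) =
    if s % 2 = 0 then (min s (2 * s - t), min s t) else (min s t, min s (2 * s - t)) := by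
  have : (s * s + t).sqrt = s := Nat.sqrt_add_eq s (by omega)
  simp [shellPath, this]

lemma shellPath_bijective : Function.Bijective shellPath := by
  constructor
  · intro n n' h
    obtain ⟨s, t, ht, rfl⟩ := exists_shell n
    obtain ⟨s', t', ht', rfl⟩ := exists_shell n'
    rw [shellPath_add ht, shellPath_add ht'] at h
    have hs : s = s' := by
      split_ifs at h <;> simp only [Prod.mk.injEq] at h <;> omega
    subst hs
    have : t = t' := by
      split_ifs at h <;> simp only [Prod.mk.injEq] at h <;> omega
    rw [this]
  · rintro ⟨a, b⟩
    by_cases hs : max a b % 2 = 0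
    · refine ⟨max a b * max a b + (max a b + b - a), ?_⟩
      rw [shellPath_add (by omega), if_pos hs]
      ext <;> simp only <;> omega
    · refine ⟨max a b * max a b + (max a b + a - b), ?_⟩
      rw [shellPath_add (by omega), if_neg hs]
      ext <;> simp only <;> omega

lemma shellPath_adjacent (n : ℕ) :
    |((shellPath (n + 1)).1 : ℤ) - (shellPath n).1| +
      |((shellPath (n + 1)).2 : ℤ) - (shellPath n).2| = 1 := by
  obtain ⟨s, t, ht, rfl⟩ := exists_shell n
  rcases ht.lt_or_eq with h | h
  · rw [add_assoc, shellPath_add ht, shellPath_add (show t + 1 ≤ 2 * s by omega)]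
    split_ifs <;> simp only [abs_eq_max_neg] <;> omega
  · have e : s * s + t + 1 = (s + 1) * (s + 1) + 0 := by rw [h]; ring
    rw [e, shellPath_add ht, shellPath_add (Nat.zero_le _)]
    split_ifs <;> simp only [abs_eq_max_neg] <;> omega

/-- The grid `ℕ ^ (d + 1)` has a one-way infinite Hamiltonian path. -/
lemma exists_gridPath (d : ℕ) : ∃ f : ℕ → (Fin (d + 1) → ℕ), Function.Bijective f ∧
    ∀ n, ∑ i, |(f (n + 1) i : ℤ) - f n i| = 1 := by
  induction d with
  | zero =>
    refine ⟨fun n _ => n, ⟨fun a b h => congrFun h 0, fun g => ⟨g 0, ?_⟩⟩, fun n => by simp⟩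
    ext i
    rw [Fin.fin_one_eq_zero i]
  | succ d ih =>
    obtain ⟨f, hf, hadj⟩ := ih
    have hadj' : ∀ a b : ℕ, |(b : ℤ) - a| = 1 → ∑ i, |(f b i : ℤ) - f a i| = 1 := by
      intro a b h
      have : b = a + 1 ∨ a = b + 1 := by
        rw [abs_eq_max_neg] at h
        omega
      rcases this with rfl | rfl
      · exact hadj a
      · simp_rw [abs_sub_comm (f b _ : ℤ)]
        exact hadj b
    refine ⟨fun n => Fin.cons (shellPath n).2 (f (shellPath n).1), ⟨?_, ?_⟩, ?_⟩
    · intro a b h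
      obtain ⟨h2, h1⟩ := Fin.cons_inj.1 h
      exact shellPath_bijective.1 (Prod.ext (hf.1 h1) h2)
    · intro g
      obtain ⟨a, ha⟩ := hf.2 (Fin.tail g)
      obtain ⟨n, hn⟩ := shellPath_bijective.2 (a, g 0)
      exact ⟨n, by simp [hn, ha, Fin.cons_self_tail]⟩
    · intro n
      have h := shellPath_adjacent n
      simp only [Fin.sum_univ_succ (n := d + 1), Fin.cons_zero, Fin.cons_succ]
      generalize shellPath n = p at *
      generalize shellPath (n + 1) = q at *
      have : |(q.2 : ℤ) - p.2| = 1 ∧ q.1 = p.1 ∨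
          |(q.2 : ℤ) - p.2| = 0 ∧ |(q.1 : ℤ) - p.1| = 1 := by
        simp only [abs_eq_max_neg] at *
        omega
      rcases this with ⟨h2, h1⟩ | ⟨h2, h1⟩
      · rw [h2, h1]; simp
      · rw [h2, hadj' _ _ h1]; simp

lemma exists_pnat_gridPath {d : ℕ} (hd : 1 ≤ d) :
    ∃ h : ℕ+ → (Fin d → ℕ+), Function.Bijective h ∧
      ∀ l, ∑ i, |((h (l + 1) i : ℕ) : ℤ) - ((h l i : ℕ) : ℤ)| = 1 := by
  obtain ⟨d, rfl⟩ := Nat.exists_eq_add_of_le' hd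
  obtain ⟨f, hf, hadj⟩ := exists_gridPath d
  refine ⟨fun l => Equiv.piCongrRight (fun _ => Equiv.pnatEquivNat.symm)
    (f (Equiv.pnatEquivNat l)), ?_, fun l => ?_⟩
  · exact (Equiv.bijective _).comp (hf.comp Equiv.pnatEquivNat.bijective)
  · have hl : (l + 1).natPred = l.natPred + 1 := by
      have := l.natPred_add_one
      have := (l + 1).natPred_add_one
      have := PNat.add_coe l 1
      simp only [PNat.one_coe] at *
      omega
    simpa [hl] using hadj l.natPred

lemma exists_unique_step {ι : Type*} [Fintype ι] {u : ι → ℤ} (h : ∑ i, |u i| = 1) :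
    ∃ i, |u i| = 1 ∧ ∀ j, j ≠ i → u j = 0 := by
  classical
  obtain ⟨i, hi⟩ : ∃ i, u i ≠ 0 := by
    by_contra! hu
    simp [hu] at h
  have h1 := Int.one_le_abs hi
  rw [← Finset.add_sum_erase _ _ (Finset.mem_univ i)] at h
  have h0 : 0 ≤ ∑ j ∈ Finset.univ.erase i, |u j| := Finset.sum_nonneg fun _ _ => abs_nonneg _
  refine ⟨i, by omega, fun j hj => ?_⟩
  have hz : ∑ j ∈ Finset.univ.erase i, |u j| = 0 := by omega
  rw [Finset.sum_eq_zero_iff_of_nonneg fun _ _ => abs_nonneg _] at hz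
  exact abs_eq_zero.1 (hz j (by simp [hj]))

end GridPath

section OneDimensional

lemma integral_cos_int_mul {a : ℝ} (ha : 0 < a) {m : ℤ} (hm : m ≠ 0) :
    ∫ x in (0 : ℝ)..a, Real.cos (m * Real.pi * x / a) = 0 := by
  have hm' : (m : ℝ) ≠ 0 := Int.cast_ne_zero.2 hm
  have hpi := Real.pi_ne_zero
  have hd : ∀ x ∈ Set.uIcc 0 a, HasDerivAt
      (fun x : ℝ => a / (m * Real.pi) * Real.sin (m * Real.pi * x / a))
      (Real.cos (m * Real.pi * x / a)) x := by
    intro x _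
    have h1 : HasDerivAt (fun x : ℝ => m * Real.pi * x / a) (m * Real.pi * 1 / a) x :=
      ((hasDerivAt_id x).const_mul _).div_const _
    refine (h1.sin.const_mul (a / (m * Real.pi))).congr_deriv ?_
    have := ha.ne'
    field_simp
  rw [intervalIntegral.integral_eq_sub_of_hasDerivAt hd
    (Continuous.intervalIntegrable (by fun_prop) _ _)]
  simp [ha.ne', Real.sin_int_mul_pi]

lemma integral_mul_cos_int_mul {a : ℝ} (ha : 0 < a) {m : ℤ} (hm : Odd m) :
    ∫ x in (0 : ℝ)..a, x * Real.cos (m * Real.pi * x / a) = -2 * a ^ 2 / (m * Real.pi) ^ 2 := by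
  have hm0 : m ≠ 0 := by rintro rfl; simp at hm
  have hm' : (m : ℝ) ≠ 0 := Int.cast_ne_zero.2 hm0
  have hpi := Real.pi_ne_zero
  have hd : ∀ x ∈ Set.uIcc 0 a, HasDerivAt
      (fun x : ℝ => x * (a / (m * Real.pi) * Real.sin (m * Real.pi * x / a)) +
        (a / (m * Real.pi)) ^ 2 * Real.cos (m * Real.pi * x / a))
      (x * Real.cos (m * Real.pi * x / a)) x := by
    intro x _
    have h1 : HasDerivAt (fun x : ℝ => m * Real.pi * x / a) (m * Real.pi * 1 / a) x :=
      ((hasDerivAt_id x).const_mul _).div_const _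
    refine (((hasDerivAt_id x).mul (h1.sin.const_mul (a / (m * Real.pi)))).add
      (h1.cos.const_mul ((a / (m * Real.pi)) ^ 2))).congr_deriv ?_
    have := ha.ne'
    simp only [id]
    field_simp
    ring
  rw [intervalIntegral.integral_eq_sub_of_hasDerivAt hd
    (Continuous.intervalIntegrable (by fun_prop) _ _)]
  have hc : Real.cos (m * Real.pi) = -1 := by
    rw [Real.cos_int_mul_pi, hm.neg_one_zpow]
  simp only [mul_div_assoc, div_self ha.ne', mul_one, Real.sin_int_mul_pi, hc]
  simp
  field_simp
  ring

/-- The product of the `k`-th and the `l`-th Dirichlet sine on `(0, a)`. -/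
noncomputable def sinProd (a : ℝ) (k l : ℕ) (x : ℝ) : ℝ :=
  Real.sin (k * Real.pi * x / a) * Real.sin (l * Real.pi * x / a)

@[fun_prop]
lemma continuous_sinProd (a : ℝ) (k l : ℕ) : Continuous (sinProd a k l) := by
  unfold sinProd
  fun_prop

lemma abs_sinProd_le_one (a : ℝ) (k l : ℕ) (x : ℝ) : |sinProd a k l x| ≤ 1 := by
  rw [sinProd, abs_mul]
  exact mul_le_one₀ (Real.abs_sin_le_one _) (abs_nonneg _) (Real.abs_sin_le_one _)

lemma sinProd_comm (a : ℝ) (k l : ℕ) : sinProd a k l = sinProd a l k :=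
  funext fun _ => mul_comm _ _

lemma sinProd_eq_cos_sub_cos (a : ℝ) (k l : ℕ) (x : ℝ) : sinProd a k l x =
    (1 / 2) * (Real.cos (((k - l : ℤ) : ℝ) * Real.pi * x / a) -
      Real.cos (((k + l : ℤ) : ℝ) * Real.pi * x / a)) := by
  have h1 : ((k - l : ℤ) : ℝ) * Real.pi * x / a =
      k * Real.pi * x / a - l * Real.pi * x / a := by push_cast; ring
  have h2 : ((k + l : ℤ) : ℝ) * Real.pi * x / a =
      k * Real.pi * x / a + l * Real.pi * x / a := by push_cast; ring
  rw [h1, h2, Real.cos_sub, Real.cos_add, sinProd]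
  ring

lemma setIntegral_Ioo_eq {a : ℝ} (ha : 0 < a) (f : ℝ → ℝ) :
    ∫ x in Set.Ioo 0 a, f x = ∫ x in (0 : ℝ)..a, f x := by
  rw [intervalIntegral.integral_of_le ha.le, integral_Ioc_eq_integral_Ioo]

lemma integral_sinProd_of_ne {a : ℝ} (ha : 0 < a) {k l : ℕ} (h : k ≠ l) :
    ∫ x in Set.Ioo 0 a, sinProd a k l x = 0 := by
  simp_rw [setIntegral_Ioo_eq ha, sinProd_eq_cos_sub_cos]
  rw [intervalIntegral.integral_const_mul, intervalIntegral.integral_sub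
    (Continuous.intervalIntegrable (by fun_prop) _ _)
    (Continuous.intervalIntegrable (by fun_prop) _ _),
    integral_cos_int_mul ha (by omega), integral_cos_int_mul ha (by omega)]
  simp

lemma integral_sinProd_self {a : ℝ} (ha : 0 < a) {k : ℕ} (h : 0 < k) :
    ∫ x in Set.Ioo 0 a, sinProd a k k x = a / 2 := by
  simp_rw [setIntegral_Ioo_eq ha, sinProd_eq_cos_sub_cos]
  rw [intervalIntegral.integral_const_mul, intervalIntegral.integral_sub
    (Continuous.intervalIntegrable (by fun_prop) _ _)
    (Continuous.intervalIntegrable (by fun_prop) _ _),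
    integral_cos_int_mul ha (m := (k + k : ℤ)) (by omega)]
  simp
  ring

lemma integral_mul_sinProd_succ {a : ℝ} (ha : 0 < a) (k : ℕ) :
    ∫ x in Set.Ioo 0 a, x * sinProd a (k + 1) k x =
      -(a ^ 2 / Real.pi ^ 2 * (1 - 1 / (2 * k + 1) ^ 2)) := by
  have e : ∀ x, x * sinProd a (k + 1) k x =
      (1 / 2) * (x * Real.cos (((1 : ℤ) : ℝ) * Real.pi * x / a) -
      x * Real.cos (((2 * k + 1 : ℤ) : ℝ) * Real.pi * x / a)) := by
    intro x
    rw [sinProd_eq_cos_sub_cos]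
    have h1 : (((k + 1 : ℕ) : ℤ) - (k : ℤ)) = 1 := by push_cast; ring
    have h2 : (((k + 1 : ℕ) : ℤ) + (k : ℤ)) = 2 * k + 1 := by push_cast; ring
    rw [h1, h2]
    ring
  simp_rw [setIntegral_Ioo_eq ha, e]
  rw [intervalIntegral.integral_const_mul, intervalIntegral.integral_sub
    (Continuous.intervalIntegrable (by fun_prop) _ _)
    (Continuous.intervalIntegrable (by fun_prop) _ _),
    integral_mul_cos_int_mul ha odd_one, integral_mul_cos_int_mul ha (odd_two_mul_add_one _)]
  have : (2 * (k : ℝ) + 1) ≠ 0 := by positivity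
  have := Real.pi_ne_zero
  push_cast
  field_simp
  ring

lemma le_abs_integral_mul_sinProd {a : ℝ} (ha : 0 < a) {k l : ℕ} (hk : 0 < k) (hl : 0 < l)
    (h : |(l : ℤ) - k| = 1) :
    a ^ 2 / (2 * Real.pi ^ 2) ≤ |∫ x in Set.Ioo 0 a, x * sinProd a k l x| := by
  wlog hkl : k = l + 1 generalizing k l
  · rw [sinProd_comm]
    rw [abs_eq_max_neg] at h
    exact this hl hk (by rw [abs_eq_max_neg]; omega) (by omega)
  subst hkl
  rw [integral_mul_sinProd_succ ha, abs_neg]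
  refine le_trans ?_ (le_abs_self _)
  have hl' : (1 : ℝ) ≤ l := by exact_mod_cast hl
  have h1 : 1 / (2 * (l : ℝ) + 1) ^ 2 ≤ 1 / 2 :=
    one_div_le_one_div_of_le (by norm_num) (by nlinarith)
  have h2 : a ^ 2 / (2 * Real.pi ^ 2) = a ^ 2 / Real.pi ^ 2 * (1 / 2) := by
    have := Real.pi_ne_zero
    field_simp
  rw [h2]
  gcongr
  linarith

end OneDimensional

section Box

variable {ι : Type*} [Fintype ι]

lemma setIntegral_pi_prod (s : ι → Set ℝ) (f : ι → ℝ → ℝ) :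
    ∫ x in Set.univ.pi s, ∏ i, f i (x i) = ∏ i, ∫ x in s i, f i x := by
  rw [volume_pi, Measure.restrict_pi_pi, integral_fintype_prod_eq_prod]

lemma setIntegral_pi_coord_mul_prod [DecidableEq ι] (s : ι → Set ℝ) (f : ι → ℝ → ℝ) (j : ι) :
    ∫ x in Set.univ.pi s, x j * ∏ i, f i (x i) =
      (∫ x in s j, x * f j x) * ∏ i ∈ Finset.univ.erase j, ∫ x in s i, f i x := by
  have e : ∀ x : ι → ℝ, x j * ∏ i, f i (x i) =
      ∏ i, (fun y => (if i = j then y else 1) * f i y) (x i) := by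
    intro x
    rw [Finset.prod_mul_distrib, Finset.prod_ite_eq' _ _ (fun i => x i)]
    simp
  rw [funext e, setIntegral_pi_prod s fun i y => (if i = j then y else 1) * f i y,
    ← Finset.mul_prod_erase _ _ (Finset.mem_univ j)]
  congr 1
  · simp
  · refine Finset.prod_congr rfl fun i hi => ?_
    simp [Finset.ne_of_mem_erase hi]

variable {a : ι → ℝ} {k l : ι → ℕ}

lemma continuous_prod_sinProd : Continuous fun x : ι → ℝ => ∏ i, sinProd (a i) (k i) (l i) (x i) :=
  continuous_finsetProd _ fun i _ => (continuous_sinProd _ _ _).comp (continuous_apply i)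

lemma abs_prod_sinProd_le_one (x : ι → ℝ) : |∏ i, sinProd (a i) (k i) (l i) (x i)| ≤ 1 := by
  rw [Finset.abs_prod]
  exact Finset.prod_le_one (fun _ _ => abs_nonneg _) fun _ _ => abs_sinProd_le_one _ _ _ _

lemma integrableOn_box_of_continuous {f : (ι → ℝ) → ℝ} (hf : Continuous f) :
    IntegrableOn f (Set.univ.pi fun j => Set.Ioo 0 (a j)) :=
  (hf.continuousOn.integrableOn_compact
    (isCompact_univ_pi fun j => isCompact_Icc (a := 0) (b := a j))).mono_set
    (Set.pi_mono fun _ _ => Set.Ioo_subset_Icc_self)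

lemma setIntegral_affine_mul_prod_sinProd [DecidableEq ι] (ha : ∀ i, 0 < a i)
    (hk : ∀ i, 0 < k i) {i : ι} (hi : k i ≠ l i) (hj : ∀ j, j ≠ i → k j = l j)
    (L : (ι → ℝ) →L[ℝ] ℝ) (c : ℝ) :
    ∫ x in Set.univ.pi fun j => Set.Ioo 0 (a j),
        (c + L x) * ∏ j, sinProd (a j) (k j) (l j) (x j) =
      L (Pi.single i 1) * ((∫ x in Set.Ioo 0 (a i), x * sinProd (a i) (k i) (l i) x) *
        ∏ j ∈ Finset.univ.erase i, (a j / 2)) := by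
  have hL : ∀ x, L x = ∑ j, L (Pi.single j 1) * x j := by
    intro x
    conv_lhs => rw [pi_eq_sum_univ' x, map_sum]
    refine Finset.sum_congr rfl fun j _ => ?_
    rw [map_smul, smul_eq_mul, mul_comm]
  have e : ∀ x : ι → ℝ, (c + L x) * ∏ j, sinProd (a j) (k j) (l j) (x j) =
      c * ∏ j, sinProd (a j) (k j) (l j) (x j) +
      ∑ m, L (Pi.single m 1) * (x m * ∏ j, sinProd (a j) (k j) (l j) (x j)) := by
    intro x
    rw [hL, add_mul, Finset.sum_mul]
    simp_rw [mul_assoc]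
  have hc := continuous_prod_sinProd (a := a) (k := k) (l := l)
  simp_rw [e]
  rw [integral_add (integrableOn_box_of_continuous (by fun_prop))
    (integrableOn_box_of_continuous (by fun_prop)), integral_finsetSum _ fun m _ =>
    integrableOn_box_of_continuous (by fun_prop)]
  simp_rw [integral_const_mul]
  rw [setIntegral_pi_prod (fun j => Set.Ioo 0 (a j)) fun j => sinProd (a j) (k j) (l j),
    Finset.prod_eq_zero (Finset.mem_univ i) (integral_sinProd_of_ne (ha i) hi), mul_zero,
    zero_add]
  simp_rw [setIntegral_pi_coord_mul_prod (fun j => Set.Ioo 0 (a j))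
    fun j => sinProd (a j) (k j) (l j)]
  rw [Finset.sum_eq_single i]
  · congr 2
    refine Finset.prod_congr rfl fun j hji => ?_
    rw [← hj j (Finset.ne_of_mem_erase hji), integral_sinProd_self (ha j) (hk j)]
  · intro m _ hm
    rw [Finset.prod_eq_zero (Finset.mem_erase.2 ⟨hm.symm, Finset.mem_univ i⟩)
      (integral_sinProd_of_ne (ha i) hi), mul_zero, mul_zero]
  · simp

/-- If `Z` is close enough on a box to an affine function, then it couples two Dirichlet
eigenfunctions of the box whose multi-indices are grid-adjacent. -/
lemma setIntegral_mul_prod_sinProd_ne_zero [DecidableEq ι] (ha : ∀ i, 0 < a i)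
    (hk : ∀ i, 0 < k i) (hl : ∀ i, 0 < l i) {i : ι} (hi : |(l i : ℤ) - k i| = 1)
    (hj : ∀ j, j ≠ i → k j = l j) {Z : (ι → ℝ) → ℝ} (hZ : Measurable Z)
    {L : (ι → ℝ) →L[ℝ] ℝ} {c η : ℝ}
    (hη : ∀ x ∈ Set.univ.pi fun j => Set.Ioo 0 (a j), |Z x - (c + L x)| ≤ η)
    (hη' : η * 2 ^ Fintype.card ι < |L (Pi.single i 1)| * (a i / Real.pi ^ 2)) :
    ∫ x in Set.univ.pi fun j => Set.Ioo 0 (a j),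
        Z x * ∏ j, sinProd (a j) (k j) (l j) (x j) ≠ 0 := by
  set B : Set (ι → ℝ) := Set.univ.pi fun j => Set.Ioo 0 (a j) with hB
  have hBm : MeasurableSet B := MeasurableSet.univ_pi fun _ => measurableSet_Ioo
  have hvol : volume.real B = ∏ j, a j := by
    rw [measureReal_def, hB, Real.volume_pi_Ioo_toReal fun j => (ha j).le]
    simp
  have hfin : volume B < ⊤ := by
    rw [hB, Real.volume_pi_Ioo]
    exact ENNReal.prod_lt_top fun _ _ => ENNReal.ofReal_lt_top
  set P : (ι → ℝ) → ℝ := fun x => ∏ j, sinProd (a j) (k j) (l j) (x j) with hP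
  have hPc : Continuous P := continuous_prod_sinProd
  have hbound : ∀ x ∈ B, ‖(Z x - (c + L x)) * P x‖ ≤ η := by
    intro x hx
    rw [Real.norm_eq_abs, abs_mul]
    exact (mul_le_of_le_one_right (abs_nonneg _) (abs_prod_sinProd_le_one x)).trans (hη x hx)
  have hI : IntegrableOn (fun x => (Z x - (c + L x)) * P x) B := by
    refine IntegrableOn.of_bound hfin (Measurable.aestronglyMeasurable ?_) η
      ((ae_restrict_iff' hBm).2 (Filter.Eventually.of_forall hbound))
    exact (hZ.sub (by fun_prop)).mul hPc.measurable
  have hIL : IntegrableOn (fun x => (c + L x) * P x) B :=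
    integrableOn_box_of_continuous (by fun_prop)
  have hsplit : ∫ x in B, Z x * P x =
      (∫ x in B, (Z x - (c + L x)) * P x) + ∫ x in B, (c + L x) * P x := by
    rw [← integral_add hI hIL]
    congr 1
    ext x
    ring
  have herr := norm_setIntegral_le_of_norm_le_const hfin hbound
  have hmain := setIntegral_affine_mul_prod_sinProd ha hk (i := i) (l := l)
    (by rintro h; simp [h] at hi) hj L c
  have hprod : 0 < ∏ j ∈ Finset.univ.erase i, (a j / 2) :=
    Finset.prod_pos fun j _ => half_pos (ha j)
  have hV : ∏ j, a j =
      2 ^ Fintype.card ι * (a i / 2 * ∏ j ∈ Finset.univ.erase i, (a j / 2)) := by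
    rw [Finset.mul_prod_erase Finset.univ (fun j => a j / 2) (Finset.mem_univ i),
      Finset.prod_div_distrib, Finset.prod_const, Finset.card_univ]
    field_simp
  have hlow : |L (Pi.single i 1)| * (a i ^ 2 / (2 * Real.pi ^ 2) *
      ∏ j ∈ Finset.univ.erase i, (a j / 2)) ≤ |∫ x in B, (c + L x) * P x| := by
    rw [hmain, abs_mul, abs_mul, abs_of_pos hprod]
    gcongr
    exact le_abs_integral_mul_sinProd (ha i) (hk i) (hl i) hi
  intro h0
  have habs : |∫ x in B, (c + L x) * P x| = ‖∫ x in B, (Z x - (c + L x)) * P x‖ := by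
    rw [Real.norm_eq_abs, ← abs_neg]
    congr 1
    linarith
  have hle := (hlow.trans habs.le).trans herr
  rw [hvol, hV] at hle
  have hpos : 0 < a i / 2 * ∏ j ∈ Finset.univ.erase i, (a j / 2) :=
    mul_pos (half_pos (ha i)) hprod
  have hlt := mul_lt_mul_of_pos_right hη' hpos
  refine absurd (hle.trans_lt (lt_of_eq_of_lt (by ring) hlt)) (not_lt.2 (le_of_eq ?_))
  have := Real.pi_ne_zero
  field_simp

end Box

lemma psiA_mul_psiA (d : ℕ) (r : Fin d → ℝ) (α : ℝ) (k l : Fin d → ℕ) (x : Fin d → ℝ) :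
    psiA d r α k x * psiA d r α l x =
      ((2 : ℝ) ^ ((d : ℝ) / 2) / (α ^ ((d : ℝ) / 2) * Real.sqrt (∏ i, r i))) ^ 2 *
        ∏ i, sinProd (α * r i) (k i) (l i) (x i) := by
  simp only [psiA, sinProd, Finset.prod_mul_distrib]
  ring

/-- Explicit form of Lemma 4.1: for `Z` measurable, essentially bounded near `0`,
differentiable at `0` with all partials nonzero, there exist `α > 0` and a bijection
`h : ℕ → ℕ^d` such that consecutive multi-indices are grid-adjacent and
`∫_{B_α} Z ψ_{h(l)}^α ψ_{h(l+1)}^α ≠ 0` for every `l`. -/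
theorem stmt7 (d : ℕ) (hd : 1 ≤ d)
    (Z : (Fin d → ℝ) → ℝ) (hZmeas : Measurable Z)
    (hZbdd : ∃ U ∈ nhds (0 : Fin d → ℝ), ∃ C : ℝ, ∀ᵐ x ∂volume, x ∈ U → |Z x| ≤ C)
    (hZdiff : DifferentiableAt ℝ Z 0)
    (hZgrad : ∀ i : Fin d, fderiv ℝ Z 0 (Pi.single i 1) ≠ 0)
    (r : Fin d → ℝ) (hr : ∀ i, 0 < r i) :
    ∃ α : ℝ, 0 < α ∧ ∃ h : ℕ+ → (Fin d → ℕ+), Function.Bijective h ∧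
      ∀ l : ℕ+,
        (∑ i : Fin d, |((h (l + 1) i : ℕ) : ℤ) - ((h l i : ℕ) : ℤ)| = 1) ∧
        (∫ x in Set.univ.pi fun j => Set.Ioo 0 (α * r j),
            Z x * psiA d r α (fun i => (h l i : ℕ)) x *
              psiA d r α (fun i => (h (l + 1) i : ℕ)) x) ≠ 0 := by
  classical
  obtain ⟨h, hbij, hadj⟩ := exists_pnat_gridPath hd
  have hr0 : 0 < ‖r‖ := (hr ⟨0, hd⟩).trans_le ((le_abs_self _).trans (norm_le_pi_norm r _))
  set L := fderiv ℝ Z 0 with hL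
  let ε : Fin d → ℝ := fun i => |L (Pi.single i 1)| * r i / (2 * Real.pi ^ 2 * 2 ^ d * ‖r‖)
  have hε : ∀ i, 0 < ε i := fun i => by
    have := abs_pos.2 (hZgrad i)
    have := hr i
    have := Real.pi_pos
    positivity
  have hev : ∀ᶠ x in nhds (0 : Fin d → ℝ), ∀ i, |Z x - (Z 0 + L x)| ≤ ε i * ‖x‖ := by
    rw [Filter.eventually_all]
    intro i
    filter_upwards [hZdiff.hasFDerivAt.isLittleO.def (hε i)] with x hx
    simpa [sub_sub, ← hL] using hx
  obtain ⟨δ, hδ, hball⟩ := Metric.eventually_nhds_iff_ball.1 hev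
  set α := δ / (2 * ‖r‖) with hα
  have hα0 : 0 < α := by positivity
  have hαr : α * ‖r‖ < δ := by
    rw [hα]
    field_simp
    linarith
  have ha : ∀ i, 0 < α * r i := fun i => mul_pos hα0 (hr i)
  refine ⟨α, hα0, h, hbij, fun l => ⟨hadj l, ?_⟩⟩
  obtain ⟨i, hi, hj⟩ := exists_unique_step (hadj l)
  simp_rw [mul_assoc (Z _), psiA_mul_psiA, mul_left_comm (Z _)]
  rw [integral_const_mul]
  refine mul_ne_zero ?_ ?_
  · have := Finset.prod_pos fun i (_ : i ∈ Finset.univ) => hr i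
    positivity
  refine setIntegral_mul_prod_sinProd_ne_zero ha (fun i => (h l i).pos)
    (fun i => (h (l + 1) i).pos) hi (fun j hji => ?_) hZmeas (L := L) (c := Z 0)
    (η := ε i * (α * ‖r‖)) (fun x hx => ?_) ?_
  · have := hj j hji
    omega
  · have hx' : ‖x‖ ≤ α * ‖r‖ := by
      refine (pi_norm_le_iff_of_nonneg (by positivity)).2 fun j => ?_
      have hxj := hx j (Set.mem_univ j)
      rw [Real.norm_eq_abs, abs_of_pos hxj.1]
      refine hxj.2.le.trans ?_
      gcongr
      exact (le_abs_self _).trans (norm_le_pi_norm r j)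
    refine (hball x (by simpa using hx'.trans_lt hαr) i).trans ?_
    gcongr
    exact (hε i).le
  · have hpos : 0 < |L (Pi.single i 1)| * (α * r i / Real.pi ^ 2) :=
      mul_pos (abs_pos.2 (hZgrad i)) (div_pos (ha i) (by positivity))
    have heq : ε i * (α * ‖r‖) * 2 ^ Fintype.card (Fin d) =
        |L (Pi.single i 1)| * (α * r i / Real.pi ^ 2) / 2 := by
      have := Real.pi_ne_zero
      simp only [ε, Fintype.card_fin]
      field_simp
    rw [heq]
    linarith
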